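/- Let Γ be a group with a convergence action on a compact metric space Z, and suppose Γ is nonelementary, i.e. its limit set Λ(Γ) contains at least 3 points. Then Λ(Γ) is a closed Γ-invariant subset of Z, Λ(Γ) is perfect, and the action of Γ on Λ(Γ) is minimal: for every λ ∈ Λ(Γ) the orbit Γλ is dense in Λ(Γ). -/

import Mathlib

open Filter Metric Set Topology

/-- A sequence in a group diverges to infinity if it eventually leaves every finite subset. -/
def DivergesToInfinity {G : Type*} (γ : ℕ → G) : Prop :=
  ∀ F : Finset G, {n : ℕ | γ n ∈ F}.Finite

/-- A convergence action: every sequence diverging to infinity has a subsequence converging,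
uniformly on compact subsets of the complement of an exceptional point, to a constant map. -/
def ConvergenceAction (G Z : Type*) [Group G] [MetricSpace Z] [MulAction G Z] : Prop :=
  ∀ γ : ℕ → G, DivergesToInfinity γ →
    ∃ (zp zm : Z) (k : ℕ → ℕ), StrictMono k ∧
      ∀ K : Set Z, IsCompact K → K ⊆ {zm}ᶜ →
        TendstoUniformlyOn (fun i z => γ (k i) • z) (fun _ => zp) atTop K

/-- The limit set: the set of limit points `zp` of sequences diverging to infinity in the
group, i.e. such that the maps converge to the constant `zp` uniformly on compact subsets
of the complement of some exceptional point `zm`. -/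
def limitSet (G Z : Type*) [Group G] [MetricSpace Z] [MulAction G Z] : Set Z :=
  {zp : Z | ∃ (γ : ℕ → G) (zm : Z), DivergesToInfinity γ ∧
    ∀ K : Set Z, IsCompact K → K ⊆ {zm}ᶜ →
      TendstoUniformlyOn (fun n z => γ n • z) (fun _ => zp) atTop K}

theorem DivergesToInfinity.of_forall_finite {G : Type*} {γ : ℕ → G}
    (h : ∀ g, {n | γ n = g}.Finite) : DivergesToInfinity γ := by
  intro F
  refine (F.finite_toSet.biUnion fun g _ => h g).subset ?_
  intro n hn
  simpa using hn

theorem DivergesToInfinity.of_injective {G : Type*} {γ : ℕ → G} (h : Function.Injective γ) :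
    DivergesToInfinity γ :=
  fun F => F.finite_toSet.preimage h.injOn

section ConvergenceAction

variable {G Z : Type*} [Group G] [MetricSpace Z] [MulAction G Z]

theorem tendsto_smul_of_tendstoUniformlyOn_compact {γ : ℕ → G} {p m v : Z}
    (h : ∀ K : Set Z, IsCompact K → K ⊆ {m}ᶜ →
      TendstoUniformlyOn (fun n z => γ n • z) (fun _ => p) atTop K) (hv : v ≠ m) :
    Tendsto (fun n => γ n • v) atTop (𝓝 p) :=
  (h {v} isCompact_singleton (by simpa using hv.symm)).tendsto_at (mem_singleton v)

theorem ConvergenceAction.exists_pointwise (hconv : ConvergenceAction G Z) {γ : ℕ → G}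
    (hγ : DivergesToInfinity γ) :
    ∃ (p m : Z) (k : ℕ → ℕ), StrictMono k ∧
      ∀ v, v ≠ m → Tendsto (fun i => γ (k i) • v) atTop (𝓝 p) := by
  obtain ⟨p, m, k, hk, h⟩ := hconv γ hγ
  exact ⟨p, m, k, hk, fun v hv =>
    tendsto_smul_of_tendstoUniformlyOn_compact (γ := fun i => γ (k i)) h hv⟩

theorem mem_limitSet_iff [CompactSpace Z] {p : Z} :
    p ∈ limitSet G Z ↔ ∀ ε > 0, ∀ F : Finset G, ∃ g ∉ F, ∃ m : Z,
      ∀ v, ε ≤ dist v m → dist (g • v) p < ε := by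
  constructor
  · rintro ⟨γ, m, hγ, h⟩ ε hε F
    have hK : IsCompact {v : Z | ε ≤ dist v m} :=
      (isClosed_le continuous_const (continuous_id.dist continuous_const)).isCompact
    have hsub : {v : Z | ε ≤ dist v m} ⊆ {m}ᶜ := by
      rintro v hv rfl
      simp only [mem_ofPred_eq, dist_self] at hv
      linarith
    have h1 := Metric.tendstoUniformlyOn_iff.1 (h _ hK hsub) ε hε
    have h2 : ∀ᶠ n in atTop, γ n ∉ F := by
      rw [← Nat.cofinite_eq_atTop]
      exact (hγ F).eventually_cofinite_notMem
    obtain ⟨n, hn1, hn2⟩ := (h1.and h2).exists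
    exact ⟨γ n, hn2, m, fun v hv => by rw [dist_comm]; exact hn1 v hv⟩
  · classical
    intro h
    obtain ⟨f, hf, hr⟩ := exists_seq_of_forall_finset_exists
      (fun t : ℕ × G × Z => ∀ v, (1 / ((t.1 : ℝ) + 1)) ≤ dist v t.2.2 →
        dist (t.2.1 • v) p < 1 / ((t.1 : ℝ) + 1))
      (fun s t => s.1 < t.1 ∧ s.2.1 ≠ t.2.1) (by
        intro s _
        obtain ⟨N, hN⟩ := (s.image Prod.fst).exists_nat_subset_range
        obtain ⟨g, hg, m, hm⟩ := h (1 / ((N : ℝ) + 1)) (by positivity)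
          (s.image fun t => t.2.1)
        refine ⟨(N, g, m), hm, fun t ht => ⟨?_, ?_⟩⟩
        · exact Finset.mem_range.1 (hN (Finset.mem_image_of_mem _ ht))
        · rintro rfl
          exact hg (Finset.mem_image_of_mem (fun t => t.2.1) ht))
    have hmono : StrictMono fun n => (f n).1 := fun i j hij => (hr i j hij).1
    have hinj : Function.Injective fun n => (f n).2.1 := by
      intro i j hij
      by_contra hne
      rcases lt_or_gt_of_ne hne with hlt | hlt
      · exact (hr i j hlt).2 hij
      · exact (hr j i hlt).2 hij.symm
    obtain ⟨m, -, k, hk, hm⟩ := isCompact_univ.tendsto_subseq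
      (x := fun n => (f n).2.2) (fun _ => mem_univ _)
    refine ⟨fun i => (f (k i)).2.1, m, .of_injective (hinj.comp hk.injective), ?_⟩
    intro K hK hKm
    rw [Metric.tendstoUniformlyOn_iff]
    intro ε hε
    obtain ⟨δ, hδ, hKδ⟩ := Metric.isOpen_iff.1 hK.isClosed.isOpen_compl m
      (fun hmK => hKm hmK rfl)
    have hsmall : Tendsto (fun i => 1 / (((f (k i)).1 : ℝ) + 1)) atTop (𝓝 0) :=
      tendsto_one_div_add_atTop_nhds_zero_nat.comp (hmono.comp hk).tendsto_atTop
    filter_upwards [hsmall.eventually_lt_const hε,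
      hsmall.eventually_lt_const (half_pos hδ),
      Metric.tendsto_nhds.1 hm (δ / 2) (half_pos hδ)] with i h1 h2 h3 v hv
    rw [dist_comm]
    refine (hf (k i) v ?_).trans h1
    have h4 : δ ≤ dist v m := by
      by_contra hlt
      exact hKδ (mem_ball.2 (not_le.1 hlt)) hv
    have h5 := dist_triangle v (f (k i)).2.2 m
    simp only [Function.comp_apply] at h3
    linarith

theorem isClosed_limitSet [CompactSpace Z] : IsClosed (limitSet G Z) := by
  refine isClosed_of_closure_subset fun p hp => mem_limitSet_iff.2 fun ε hε F => ?_
  obtain ⟨q, hq, hpq⟩ := Metric.mem_closure_iff.1 hp (ε / 2) (half_pos hε)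
  obtain ⟨g, hg, m, hm⟩ := mem_limitSet_iff.1 hq (ε / 2) (half_pos hε) F
  refine ⟨g, hg, m, fun v hv => ?_⟩
  have h1 := hm v (by linarith)
  have h2 := dist_triangle_right (g • v) p q
  linarith

theorem smul_mem_limitSet [CompactSpace Z] [ContinuousConstSMul G Z] (g : G) {z : Z}
    (hz : z ∈ limitSet G Z) : g • z ∈ limitSet G Z := by
  classical
  obtain ⟨γ, m, hγ, h⟩ := hz
  refine ⟨fun n => g * γ n, m, fun F => ?_, fun K hK hKm => ?_⟩
  · refine (hγ (F.image fun x => g⁻¹ * x)).subset fun n hn => ?_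
    exact Finset.mem_image.2 ⟨g * γ n, hn, by simp⟩
  · have huc : UniformContinuous fun v : Z => g • v :=
      CompactSpace.uniformContinuous_of_continuous (continuous_const_smul g)
    simpa [Function.comp_def, mul_smul] using huc.comp_tendstoUniformlyOn (h K hK hKm)

/-- In a convergence group fixing `z`, an element `h` mapping the complement of a ball about `z`
into a small ball about some point has a fixed point there, to which its iterates converge. -/
theorem ConvergenceAction.exists_attracting_fixedPoint [CompactSpace Z]
    [ContinuousConstSMul G Z] (hconv : ConvergenceAction G Z) {z a b : Z} {h : G} {ε : ℝ}
    (hε : 0 < ε) (hz : h • z = z) (haz : 3 * ε ≤ dist a z) (hbz : 3 * ε ≤ dist b z)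
    (hab : 3 * ε ≤ dist a b) (hh : ∀ v, ε ≤ dist v z → dist (h • v) a < ε) :
    ∃ x, dist x a < ε ∧ h • x = x ∧ Function.Injective (fun n : ℕ => h ^ n) ∧
      ∀ v, v ≠ z → Tendsto (fun n : ℕ => h ^ n • v) atTop (𝓝 x) := by
  have hstep : ∀ v, dist v a < ε → ε ≤ dist v z := fun v hv => by
    have := dist_triangle_left a z v
    linarith
  have hpow : ∀ (n : ℕ) v, ε ≤ dist v z → ε ≤ dist (h ^ n • v) z := by
    intro n v hv
    induction n with
    | zero => simpa using hv
    | succ n ih => rw [pow_succ', mul_smul]; exact hstep _ (hh _ ih)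
  have hpow' : ∀ n : ℕ, n ≠ 0 → h ^ n ≠ 1 := by
    intro n hn h1
    obtain ⟨n, rfl⟩ := Nat.exists_eq_succ_of_ne_zero hn
    have h2 := hh _ (hpow n b (by linarith))
    rw [← mul_smul, ← pow_succ', h1, one_smul, dist_comm] at h2
    linarith
  have hfix : ∀ n : ℕ, h ^ n • z = z := by
    intro n
    induction n with
    | zero => simp
    | succ n ih => rw [pow_succ', mul_smul, ih, hz]
  have hinj : Function.Injective (fun n : ℕ => h ^ n) := by
    refine injective_pow_iff_not_isOfFinOrder.2 fun hfin => ?_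
    obtain ⟨n, hn, h1⟩ := isOfFinOrder_iff_pow_eq_one.1 hfin
    exact hpow' n hn.ne' h1
  have hsub : ∀ φ : ℕ → ℕ, StrictMono φ → ∃ (p : Z) (k : ℕ → ℕ), StrictMono k ∧ p ≠ z ∧
      h • p = p ∧ ∀ v, v ≠ z → Tendsto (fun i => h ^ φ (k i) • v) atTop (𝓝 p) := by
    intro φ hφ
    obtain ⟨p, q, k, hk, hlim⟩ := hconv.exists_pointwise (γ := fun n => h ^ φ n)
      (.of_injective (hinj.comp hφ.injective))
    have hC : IsClosed {v : Z | ε ≤ dist v z} :=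
      isClosed_le continuous_const (continuous_id.dist continuous_const)
    have hpC : ε ≤ dist p z := by
      have key : ∀ v, ε ≤ dist v z → v ≠ q → ε ≤ dist p z := fun v hv hvq =>
        hC.mem_of_tendsto (hlim v hvq) (.of_forall fun i => hpow _ v hv)
      by_cases haq : a = q
      · refine key b (by linarith) fun hbq => ?_
        rw [haq, hbq, dist_self] at hab
        linarith
      · exact key a (by linarith) haq
    have hpz : p ≠ z := by
      rintro rfl
      rw [dist_self] at hpC
      linarith
    have hqz : q = z := by
      by_contra hne
      have := hlim z (Ne.symm hne)
      simp only [hfix] at this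
      exact hpz (tendsto_nhds_unique this tendsto_const_nhds)
    subst hqz
    refine ⟨p, k, hk, hpz, ?_, hlim⟩
    have hhp : h • p ≠ q := by
      intro hc
      rw [← hz] at hc
      exact hpz (smul_left_cancel h hc)
    have h1 := (hlim p hpz).const_smul h
    have h2 := hlim (h • p) hhp
    refine tendsto_nhds_unique h1 (h2.congr fun i => ?_)
    rw [← mul_smul, ← mul_smul, pow_mul_comm']
  obtain ⟨x, k, hk, hxz, hx, hlim⟩ := hsub id strictMono_id
  have hunique : ∀ p, p ≠ z → h • p = p → p = x := by
    intro p hp hhp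
    have hpn : ∀ n : ℕ, h ^ n • p = p := by
      intro n
      induction n with
      | zero => simp
      | succ n ih => rw [pow_succ, mul_smul, hhp, ih]
    have := hlim p hp
    simp only [hpn] at this
    exact tendsto_nhds_unique tendsto_const_nhds this
  have hall : ∀ v, v ≠ z → Tendsto (fun n : ℕ => h ^ n • v) atTop (𝓝 x) := by
    intro v hv
    refine tendsto_of_subseq_tendsto fun ns hns => ?_
    obtain ⟨φ, -, hφ⟩ := strictMono_subseq_of_tendsto_atTop hns
    obtain ⟨p, k', -, hp, hhp, hlim'⟩ := hsub _ hφ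
    exact ⟨fun i => φ (k' i), by simpa [hunique p hp hhp] using hlim' v hv⟩
  have hxC : ε ≤ dist x z := by
    have hC : IsClosed {v : Z | ε ≤ dist v z} :=
      isClosed_le continuous_const (continuous_id.dist continuous_const)
    have haz' : a ≠ z := by
      rintro rfl
      rw [dist_self] at haz
      linarith
    exact hC.mem_of_tendsto (hall a haz') (.of_forall fun n => hpow n a (by linarith))
  refine ⟨x, ?_, hx, hinj, hall⟩
  rw [← hx]
  exact hh x hxC

/-- A convergence group fixing a point `z` has at most one limit point other than `z`. -/
theorem ConvergenceAction.limitSet_eq_of_fixedPoint [CompactSpace Z]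
    [ContinuousConstSMul G Z] (hconv : ConvergenceAction G Z) {z a b : Z}
    (hz : ∀ g : G, g • z = z) (ha : a ∈ limitSet G Z) (hb : b ∈ limitSet G Z)
    (haz : a ≠ z) (hbz : b ≠ z) : a = b := by
  by_contra hab
  obtain ⟨ε, hε, haz', hbz', hab'⟩ : ∃ ε > 0, 3 * ε ≤ dist a z ∧ 3 * ε ≤ dist b z ∧
      3 * ε ≤ dist a b := by
    refine ⟨min (dist a z) (min (dist b z) (dist a b)) / 3, ?_, ?_, ?_, ?_⟩
    · have := dist_pos.2 haz
      have := dist_pos.2 hbz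
      have := dist_pos.2 hab
      positivity
    all_goals rw [mul_div_cancel₀ _ (by norm_num)]
    · exact min_le_left _ _
    · exact (min_le_right _ _).trans (min_le_left _ _)
    · exact (min_le_right _ _).trans (min_le_right _ _)
  obtain ⟨h, hh⟩ : ∃ h : G, ∀ v, ε ≤ dist v z → dist (h • v) a < ε := by
    obtain ⟨γ, m, -, hγ⟩ := ha
    have hmz : m = z := by
      by_contra hne
      have := tendsto_smul_of_tendstoUniformlyOn_compact hγ (Ne.symm hne)
      simp only [hz] at this
      exact haz (tendsto_nhds_unique this tendsto_const_nhds)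
    subst hmz
    have hK : IsCompact {v : Z | ε ≤ dist v m} :=
      (isClosed_le continuous_const (continuous_id.dist continuous_const)).isCompact
    have hsub : {v : Z | ε ≤ dist v m} ⊆ {m}ᶜ := by
      rintro v hv rfl
      simp only [mem_ofPred_eq, dist_self] at hv
      linarith
    obtain ⟨n, hn⟩ := (Metric.tendstoUniformlyOn_iff.1 (hγ _ hK hsub) ε hε).exists
    exact ⟨γ n, fun v hv => by rw [dist_comm]; exact hn v hv⟩
  obtain ⟨x, hxa, hx, hinj, hlim⟩ := hconv.exists_attracting_fixedPoint hε (hz h)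
    haz' hbz' hab' hh
  have hxz' : 2 * ε < dist x z := by
    have := dist_triangle_left a z x
    linarith
  have hxz : x ≠ z := by
    rintro rfl
    rw [dist_self] at hxz'
    linarith
  have hxb : x ≠ b := by
    rintro rfl
    rw [dist_comm] at hab'
    linarith
  have hxpow : ∀ n : ℕ, h ^ n • x = x := by
    intro n
    induction n with
    | zero => simp
    | succ n ih => rw [pow_succ, mul_smul, hx, ih]
  have hxinv : ∀ n : ℕ, (h ^ n)⁻¹ • x = x := fun n => by
    rw [inv_smul_eq_iff, hxpow]
  obtain ⟨g, hg⟩ : ∃ g : G, g • x ≠ x := by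
    obtain ⟨γ, m, -, hγ⟩ := hb
    have hmz : m = z := by
      by_contra hne
      have := tendsto_smul_of_tendstoUniformlyOn_compact hγ (Ne.symm hne)
      simp only [hz] at this
      exact hbz (tendsto_nhds_unique this tendsto_const_nhds)
    subst hmz
    by_contra! hall
    have := tendsto_smul_of_tendstoUniformlyOn_compact hγ hxz
    simp only [hall] at this
    exact hxb (tendsto_nhds_unique tendsto_const_nhds this)
  have hgz : g • x ≠ z := by
    intro hc
    rw [← hz g] at hc
    exact hxz (smul_left_cancel g hc)
  have hstay : ∀ (n : ℕ) v, ε ≤ dist v z → dist (h ^ (n + 1) • v) a < ε := by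
    intro n v hv
    induction n with
    | zero => simpa using hh v hv
    | succ n ih =>
      rw [pow_succ', mul_smul]
      refine hh _ ?_
      have := dist_triangle_left a z (h ^ (n + 1) • v)
      linarith
  obtain ⟨k, hk, hbk⟩ : ∃ k : ℕ → ℕ, StrictMono k ∧
      Tendsto (fun i => (h ^ k i)⁻¹ • b) atTop (𝓝 z) := by
    obtain ⟨p, q, k, hk, hpq⟩ := hconv.exists_pointwise (γ := fun n : ℕ => (h ^ n)⁻¹)
      (.of_injective (inv_injective.comp hinj))
    have h1 : z ≠ q → z = p := fun hq => by
      have := hpq z hq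
      simp only [hz] at this
      exact tendsto_nhds_unique tendsto_const_nhds this
    have h2 : x ≠ q → x = p := fun hq => by
      have := hpq x hq
      simp only [hxinv] at this
      exact tendsto_nhds_unique tendsto_const_nhds this
    have hbq : b ≠ q := by
      rintro rfl
      exact hxz ((h2 hxb).trans (h1 hbz.symm).symm)
    have hout : dist p z ≤ ε := by
      refine (isClosed_le (continuous_id.dist continuous_const)
        continuous_const).mem_of_tendsto (hpq b hbq) ?_
      filter_upwards [eventually_gt_atTop 0] with i hi
      by_contra hlt
      obtain ⟨n, hn⟩ := Nat.exists_eq_succ_of_ne_zero (hi.trans_le (hk.id_le i)).ne'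
      have := hstay n _ (not_le.1 hlt).le
      simp only [id_eq, hn, Nat.succ_eq_add_one, smul_inv_smul] at this
      rw [dist_comm] at this
      linarith
    have hxq : x = q := by
      by_contra hne
      rw [← h2 hne] at hout
      linarith
    rw [← h1 (hxq ▸ hxz.symm)] at hpq
    exact ⟨k, hk, hpq b hbq⟩
  have hw : Tendsto (fun i => g • (h ^ k i)⁻¹ • b) atTop (𝓝 z) := by
    simpa only [hz] using hbk.const_smul g
  have hwz : ∀ i, g • (h ^ k i)⁻¹ • b ≠ z := by
    intro i hc
    rw [← mul_smul, ← hz (g * (h ^ k i)⁻¹)] at hc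
    exact hbz (smul_left_cancel _ hc)
  have hex : ∀ i, ∃ n : ℕ, ε ≤ dist (h ^ n • g • (h ^ k i)⁻¹ • b) z := by
    intro i
    have := ((hlim _ (hwz i)).dist (tendsto_const_nhds (x := z))).eventually_const_lt
      (show ε < dist x z by linarith)
    obtain ⟨n, hn⟩ := this.exists
    exact ⟨n, hn.le⟩
  classical
  -- the first time at which the iterates of `h` leave the ball of radius `ε` about `z`
  let m : ℕ → ℕ := fun i => Nat.find (hex i)
  have hm : Tendsto m atTop atTop := by
    rw [Filter.tendsto_atTop]
    intro N
    have hj : ∀ j < N, ∀ᶠ i in atTop, dist (h ^ j • g • (h ^ k i)⁻¹ • b) z < ε := by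
      intro j _
      have := hw.const_smul (h ^ j)
      rw [hz] at this
      exact Metric.tendsto_nhds.1 this ε hε
    have := (Set.finite_lt_nat N).eventually_all.2 hj
    filter_upwards [this] with i hi
    exact (Nat.le_find_iff _ _).2 fun j hjN => not_le.2 (hi j hjN)
  let u : ℕ → G := fun i => h ^ m i * g * (h ^ k i)⁻¹
  have hux : Tendsto (fun i => u i • x) atTop (𝓝 x) := by
    refine ((hlim _ hgz).comp hm).congr fun i => ?_
    simp only [u, Function.comp_apply, mul_smul, hxinv]
  have hune : ∀ i, u i • x ≠ x := by
    intro i hc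
    simp only [u, mul_smul, hxinv] at hc
    nth_rewrite 2 [← hxpow (m i)] at hc
    exact hg (smul_left_cancel _ hc)
  have hdiv : DivergesToInfinity u := by
    refine .of_forall_finite fun g₀ => ?_
    by_contra hinf
    have hfreq : ∃ᶠ i in atTop, u i = g₀ := Nat.frequently_atTop_iff_infinite.2 hinf
    obtain ⟨i, hi⟩ := hfreq.exists
    have hmem : g₀ • x = x := by
      have : x ∈ ({g₀ • x} : Set Z) := isClosed_singleton.mem_of_frequently_of_tendsto
        (hfreq.mono fun i hi => by simp [hi]) hux
      exact this.symm
    exact hune i (hi ▸ hmem)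
  obtain ⟨p, q, l, hl, hpq⟩ := hconv.exists_pointwise hdiv
  let D : Set Z := {v | ε ≤ dist v z} ∩ (fun v => h • v) '' closedBall z ε
  have hD : IsClosed D :=
    (isClosed_le continuous_const (continuous_id.dist continuous_const)).inter
      ((isCompact_closedBall z ε).image (continuous_const_smul h)).isClosed
  have huD : ∀ᶠ i in atTop, u i • b ∈ D := by
    filter_upwards [hm.eventually_gt_atTop 0] with i hi
    refine ⟨?_, h ^ (m i - 1) • g • (h ^ k i)⁻¹ • b, ?_, ?_⟩
    · simpa only [u, mul_smul, mem_ofPred_eq] using Nat.find_spec (hex i)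
    · exact (not_le.1 (Nat.find_min (hex i) (Nat.sub_lt hi one_pos))).le
    · simp only [u, ← mul_smul, ← mul_assoc, ← pow_succ', Nat.sub_add_cancel hi]
  have hzD : z ∉ D := fun hc => by
    have := hc.1
    simp only [mem_ofPred_eq, dist_self] at this
    linarith
  have hxD : x ∉ D := by
    rintro ⟨-, v, hv, hvx⟩
    have hvx' : v = x := by
      rw [← hx] at hvx
      exact smul_left_cancel h hvx
    rw [hvx', mem_closedBall] at hv
    linarith
  have h1 : z ≠ q → z = p := fun hq => by
    have := hpq z hq
    simp only [hz] at this
    exact tendsto_nhds_unique tendsto_const_nhds this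
  have h2 : x ≠ q → x = p := fun hq =>
    tendsto_nhds_unique (hux.comp hl.tendsto_atTop) (hpq x hq)
  have h3 : b ≠ q → p ∈ D := fun hq =>
    hD.mem_of_tendsto (hpq b hq) (hl.tendsto_atTop.eventually huD)
  by_cases hbq : b = q
  · subst hbq
    exact hxz ((h2 hxb).trans (h1 hbz.symm).symm)
  · have hpD := h3 hbq
    by_cases hzq : z = q
    · exact hxD ((h2 (hzq ▸ hxz)).symm ▸ hpD)
    · exact hzD ((h1 hzq).symm ▸ hpD)

end ConvergenceAction

/-- Gehring–Martin, Tukia: for a nonelementary convergence group (limit set with at least 3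
points), the limit set is closed, invariant and perfect, and the action on it is minimal. -/
theorem limit_set_minimal_and_perfect
    {G Z : Type*} [Group G] [MetricSpace Z] [CompactSpace Z] [MulAction G Z]
    (hcont : ∀ γ : G, Continuous fun z : Z => γ • z)
    (hconv : ConvergenceAction G Z)
    (hnonelem : ∃ a b c : Z, a ∈ limitSet G Z ∧ b ∈ limitSet G Z ∧ c ∈ limitSet G Z ∧
      a ≠ b ∧ a ≠ c ∧ b ≠ c) :
    IsClosed (limitSet G Z) ∧
    (∀ g : G, ∀ z ∈ limitSet G Z, g • z ∈ limitSet G Z) ∧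
    (∀ z ∈ limitSet G Z, z ∈ closure (limitSet G Z \ {z})) ∧
    (∀ z ∈ limitSet G Z, limitSet G Z ⊆ closure (Set.range fun g : G => g • z)) := by
  have : ContinuousConstSMul G Z := ⟨hcont⟩
  obtain ⟨a, b, c, ha, hb, hc, hab, hac, hbc⟩ := hnonelem
  have htwo : ∀ m : Z, ∃ v ∈ limitSet G Z, ∃ w ∈ limitSet G Z, v ≠ w ∧ v ≠ m ∧ w ≠ m := by
    intro m
    by_cases ham : a = m
    · exact ⟨b, hb, c, hc, hbc, ham ▸ hab.symm, ham ▸ hac.symm⟩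
    · by_cases hbm : b = m
      · exact ⟨a, ha, c, hc, hac, ham, hbm ▸ hbc.symm⟩
      · exact ⟨a, ha, b, hb, hab, ham, hbm⟩
  refine ⟨isClosed_limitSet, fun g z hz => smul_mem_limitSet g hz, fun z hz => ?_,
    fun z _ w hw => ?_⟩
  · obtain ⟨γ, m, -, hγ⟩ := hz
    obtain ⟨v, hv, w, hw, hvw, hvm, hwm⟩ := htwo m
    have hlv := tendsto_smul_of_tendstoUniformlyOn_compact hγ hvm
    have hlw := tendsto_smul_of_tendstoUniformlyOn_compact hγ hwm
    refine mem_closure_iff_nhds.2 fun t ht => ?_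
    obtain ⟨n, hnv, hnw⟩ := ((hlv.eventually_mem ht).and (hlw.eventually_mem ht)).exists
    by_cases hne : γ n • v = z
    · refine ⟨γ n • w, hnw, smul_mem_limitSet _ hw, fun hwz => hvw ?_⟩
      exact smul_left_cancel (γ n) (hne.trans (mem_singleton_iff.1 hwz).symm)
    · exact ⟨γ n • v, hnv, smul_mem_limitSet _ hv, hne⟩
  · obtain ⟨γ, m, -, hγ⟩ := hw
    obtain ⟨g, hg⟩ : ∃ g : G, g • z ≠ m := by
      by_contra! hall
      have hzm : z = m := by simpa using hall 1
      obtain ⟨v, hv, w, hw, hvw, hvm, hwm⟩ := htwo m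
      exact hvw (hconv.limitSet_eq_of_fixedPoint (fun g => hzm ▸ hall g) hv hw hvm hwm)
    refine mem_closure_of_tendsto
      (tendsto_smul_of_tendstoUniformlyOn_compact hγ hg) (.of_forall fun n => ?_)
    exact ⟨γ n * g, mul_smul _ _ _⟩
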